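/- Let α ∈ ℂ, U ⊆ ℂ open, and let (q₁, p₁, q₂, p₂) be differentiable functions on U solving system (3) with parameter α. Set f₁ := p₁ + 3 q₁ q₂ − (3/2)(p₂² − t) and assume f₁(t) ≠ 0 for all t ∈ U. Then the functions (q₁ + (2 − 2α)/f₁, p₁ + 6 q₂ (α−1)/f₁ + 18 p₂ (α−1)²/f₁² + 36 q₁ (α−1)³/f₁³ − 18 (α−1)⁴/f₁⁴, q₂ + 6 p₂ (α−1)/f₁ + 18 q₁ (α−1)²/f₁² − 12 (α−1)³/f₁³, p₂ + 6 q₁ (α−1)/f₁ − 6 (α−1)²/f₁²) solve system (3) with parameter 2 − α on U. (This is the Bäcklund transformation s₁.) -/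

import Mathlib

/-- `(q₁,p₁,q₂,p₂)` solves system (3) with parameter `α` on `U`:
`q₁' = q₁² + p₂`, `p₁' = -2 q₁ p₁ - α - 1/2`, `q₂' = -(1/2) p₂² + p₁ + t/2`, `p₂' = q₂`. -/
def SolvesSys3 (α : ℂ) (U : Set ℂ) (q1 p1 q2 p2 : ℂ → ℂ) : Prop :=
  ∀ t ∈ U,
    HasDerivAt q1 (q1 t ^ 2 + p2 t) t ∧
    HasDerivAt p1 (-2 * q1 t * p1 t - α - 1/2) t ∧
    HasDerivAt q2 (-(1/2) * p2 t ^ 2 + p1 t + t / 2) t ∧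
    HasDerivAt p2 (q2 t) t

/-- The Bäcklund transformation `s₁` of system (3): with
`f₁ = p₁ + 3 q₁ q₂ - (3/2)(p₂² - t)` nonvanishing on `U`, the transformed tuple
solves system (3) with parameter `2 - α`. -/
theorem stmt3 (α : ℂ) (U : Set ℂ) (hU : IsOpen U) (q1 p1 q2 p2 : ℂ → ℂ)
    (h : SolvesSys3 α U q1 p1 q2 p2)
    (f1 : ℂ → ℂ)
    (hf1 : ∀ t, f1 t = p1 t + 3 * q1 t * q2 t - (3/2) * (p2 t ^ 2 - t))
    (hne : ∀ t ∈ U, f1 t ≠ 0) :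
    SolvesSys3 (2 - α) U
      (fun t => q1 t + (2 - 2 * α) / f1 t)
      (fun t => p1 t + 6 * q2 t * (α - 1) / f1 t + 18 * p2 t * (α - 1) ^ 2 / f1 t ^ 2
        + 36 * q1 t * (α - 1) ^ 3 / f1 t ^ 3 - 18 * (α - 1) ^ 4 / f1 t ^ 4)
      (fun t => q2 t + 6 * p2 t * (α - 1) / f1 t + 18 * q1 t * (α - 1) ^ 2 / f1 t ^ 2
        - 12 * (α - 1) ^ 3 / f1 t ^ 3)
      (fun t => p2 t + 6 * q1 t * (α - 1) / f1 t - 6 * (α - 1) ^ 2 / f1 t ^ 2) := by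
  intro t ht
  obtain ⟨hq1, hp1, hq2, hp2⟩ := h t ht
  have hn := hne t ht
  have hf : HasDerivAt f1 (q1 t * f1 t + 1 - α) t := by
    have e : f1 = fun t => p1 t + 3 * (q1 t * q2 t) - (3/2) * (p2 t ^ 2 - t) := by
      funext s; rw [hf1]; ring
    have hd := (hp1.fun_add ((hq1.fun_mul hq2).const_mul 3)).fun_sub
      (((hp2.fun_pow 2).fun_sub (hasDerivAt_id' t)).const_mul (3/2))
    rw [hf1 t, e]
    refine hd.congr_deriv ?_
    push_cast
    ring
  obtain ⟨u, hu⟩ : ∃ u : ℂ → ℂ, u = fun t => (α - 1) / f1 t := ⟨_, rfl⟩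
  have hut : u t * f1 t = α - 1 := by
    rw [hu]; field_simp
  have hdu : HasDerivAt u (-q1 t * u t + u t ^ 2) t := by
    have hd := (hasDerivAt_const t (α - 1)).fun_div hf hn
    rw [hu]
    refine hd.congr_deriv ?_
    field_simp
    ring
  have e1 : (fun t => q1 t + (2 - 2 * α) / f1 t) = fun t => q1 t - 2 * u t := by
    funext s; rw [hu]; ring
  have e2 : (fun t => p1 t + 6 * q2 t * (α - 1) / f1 t + 18 * p2 t * (α - 1) ^ 2 / f1 t ^ 2
        + 36 * q1 t * (α - 1) ^ 3 / f1 t ^ 3 - 18 * (α - 1) ^ 4 / f1 t ^ 4)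
      = fun t => p1 t + 6 * (q2 t * u t) + 18 * (p2 t * u t ^ 2)
        + 36 * (q1 t * u t ^ 3) - 18 * u t ^ 4 := by
    funext s; rw [hu]; ring
  have e3 : (fun t => q2 t + 6 * p2 t * (α - 1) / f1 t + 18 * q1 t * (α - 1) ^ 2 / f1 t ^ 2
        - 12 * (α - 1) ^ 3 / f1 t ^ 3)
      = fun t => q2 t + 6 * (p2 t * u t) + 18 * (q1 t * u t ^ 2) - 12 * u t ^ 3 := by
    funext s; rw [hu]; ring
  have e4 : (fun t => p2 t + 6 * q1 t * (α - 1) / f1 t - 6 * (α - 1) ^ 2 / f1 t ^ 2)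
      = fun t => p2 t + 6 * (q1 t * u t) - 6 * u t ^ 2 := by
    funext s; rw [hu]; ring
  rw [e1, e2, e3, e4]
  rw [hf1 t] at hut
  refine ⟨?_, ?_, ?_, ?_⟩
  · refine (hq1.fun_sub (hdu.const_mul 2)).congr_deriv ?_
    ring
  · refine ((((hp1.fun_add ((hq2.fun_mul hdu).const_mul 6)).fun_add
      ((hp2.fun_mul (hdu.fun_pow 2)).const_mul 18)).fun_add
      ((hq1.fun_mul (hdu.fun_pow 3)).const_mul 36)).fun_sub
      ((hdu.fun_pow 4).const_mul 18)).congr_deriv ?_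
    push_cast
    linear_combination 2 * hut
  · refine (((hq2.fun_add ((hp2.fun_mul hdu).const_mul 6)).fun_add
      ((hq1.fun_mul (hdu.fun_pow 2)).const_mul 18)).fun_sub
      ((hdu.fun_pow 3).const_mul 12)).congr_deriv ?_
    push_cast
    ring
  · refine ((hp2.fun_add ((hq1.fun_mul hdu).const_mul 6)).fun_sub
      ((hdu.fun_pow 2).const_mul 6)).congr_deriv ?_
    push_cast
    ring
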